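/- Let n ≥ 1, let Ω be a real invertible antisymmetric 2n×2n matrix, and let f be an invertible real 2n×2n matrix with Ω = f J fᵀ. Let a ∈ 𝒮(ℝ^{2n}) and u, φ ∈ 𝒮(ℝ^n) with ‖φ‖_{L²} = 1. Then Ã_ω(W_{f,φ} u) = W_{f,φ}(Â' u) pointwise on ℝ^{2n}, where Ã_ω is the phase-space operator associated with Ω and symbol a, and Â' is the Weyl operator with symbol a' = a ∘ f. -/

import Mathlib

open MeasureTheory Matrix ComplexConjugate

/-- Split a vector in `ℝ^{2n}` into the pair `(x, ξ) ∈ ℝ^n × ℝ^n`. -/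
def splitVec (n : ℕ) (z : Fin (2 * n) → ℝ) : (Fin n → ℝ) × (Fin n → ℝ) :=
  (fun i => z ⟨(i : ℕ), by have := i.isLt; omega⟩,
   fun i => z ⟨n + (i : ℕ), by have := i.isLt; omega⟩)

/-- Merge a pair `(x, ξ) ∈ ℝ^n × ℝ^n` into a vector in `ℝ^{2n}`. -/
def mergeVec (n : ℕ) (x ξ : Fin n → ℝ) : Fin (2 * n) → ℝ := fun i =>
  if h : (i : ℕ) < n then x ⟨(i : ℕ), h⟩
  else ξ ⟨(i : ℕ) - n, by have := i.isLt; omega⟩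

/-- The symplectic form associated to an invertible antisymmetric matrix `Ω`. -/
noncomputable def symplForm {m : ℕ} (Ω : Matrix (Fin m) (Fin m) ℝ)
    (z z' : Fin m → ℝ) : ℝ :=
  z ⬝ᵥ (Ω⁻¹ *ᵥ z')

/-- The standard symplectic matrix `J = [[0, I], [−I, 0]]` of size `2n × 2n`. -/
def Jmat (n : ℕ) : Matrix (Fin (2 * n)) (Fin (2 * n)) ℝ := fun i j =>
  if (i : ℕ) + n = (j : ℕ) then 1 else if (j : ℕ) + n = (i : ℕ) then -1 else 0

/-- The `ω`-symplectic Fourier transform. -/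
noncomputable def Fomega {m : ℕ} (n : ℕ) (Ω : Matrix (Fin m) (Fin m) ℝ)
    (a : (Fin m → ℝ) → ℂ) (z : Fin m → ℝ) : ℂ :=
  ((((2 * Real.pi) ^ n : ℝ)⁻¹ : ℝ) : ℂ) * (((Real.sqrt |Ω.det|)⁻¹ : ℝ) : ℂ) *
    ∫ z' : Fin m → ℝ, Complex.exp (-Complex.I * ((symplForm Ω z z' : ℝ) : ℂ)) * a z'

/-- The phase-space operator `Ã_ω` with symbol `a`. -/
noncomputable def Atilde {m : ℕ} (n : ℕ) (Ω : Matrix (Fin m) (Fin m) ℝ)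
    (a U : (Fin m → ℝ) → ℂ) (z : Fin m → ℝ) : ℂ :=
  ((((2 * Real.pi) ^ n : ℝ)⁻¹ : ℝ) : ℂ) * (((Real.sqrt |Ω.det|)⁻¹ : ℝ) : ℂ) *
    ∫ z₀ : Fin m → ℝ, Fomega n Ω a z₀ *
      Complex.exp (-Complex.I * ((symplForm Ω z z₀ : ℝ) : ℂ)) * U (z - (1/2 : ℝ) • z₀)

/-- The cross-Wigner transform on `ℝ^n`. -/
noncomputable def crossWigner {n : ℕ} (u v : (Fin n → ℝ) → ℂ)
    (z : (Fin n → ℝ) × (Fin n → ℝ)) : ℂ :=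
  ((((2 * Real.pi) ^ n : ℝ)⁻¹ : ℝ) : ℂ) *
    ∫ y : Fin n → ℝ, Complex.exp (-Complex.I * ((z.2 ⬝ᵥ y : ℝ) : ℂ)) *
      u (z.1 + (1/2 : ℝ) • y) * conj (v (z.1 - (1/2 : ℝ) • y))

/-- The modified wave-packet transform
`W_{f,φ} u(z) = (2π)^{n/2} |det f|^{-1/2} W(u,φ)(f⁻¹ z)`. -/
noncomputable def wavePacketF (n : ℕ) (f : Matrix (Fin (2 * n)) (Fin (2 * n)) ℝ)
    (φ u : (Fin n → ℝ) → ℂ) (z : Fin (2 * n) → ℝ) : ℂ :=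
  ((Real.sqrt ((2 * Real.pi) ^ n) : ℝ) : ℂ) * (((Real.sqrt |f.det|)⁻¹ : ℝ) : ℂ) *
    crossWigner u φ (splitVec n (f⁻¹ *ᵥ z))

/-- The Weyl operator with symbol `b : ℝ^{2n} → ℂ`:
`Âu(x) = (2π)^{-n} ∬ e^{i(x−y)·ξ} b((x+y)/2, ξ) u(y) dy dξ`. -/
noncomputable def weylOpM (n : ℕ) (b : (Fin (2 * n) → ℝ) → ℂ)
    (u : (Fin n → ℝ) → ℂ) (x : Fin n → ℝ) : ℂ :=
  ((((2 * Real.pi) ^ n : ℝ)⁻¹ : ℝ) : ℂ) *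
    ∫ p : (Fin n → ℝ) × (Fin n → ℝ),
      Complex.exp (Complex.I * (((x - p.1) ⬝ᵥ p.2 : ℝ) : ℂ)) *
        b (mergeVec n ((1/2 : ℝ) • (x + p.1)) p.2) * u p.1

section PhaseSpace

variable {n : ℕ}

theorem splitVec_mergeVec (x ξ : Fin n → ℝ) : splitVec n (mergeVec n x ξ) = (x, ξ) := by
  ext i <;> simp [splitVec, mergeVec]

theorem mergeVec_splitVec (z : Fin (2 * n) → ℝ) :
    mergeVec n (splitVec n z).1 (splitVec n z).2 = z := by
  ext i
  by_cases h : (i : ℕ) < n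
  · simp [splitVec, mergeVec, h]
  · simp only [splitVec, mergeVec, h, dite_false]
    congr 1
    ext
    simp only
    omega

/-- The first `n` indices followed by the last `n` indices of `Fin (2 * n)`. -/
def sumEquivFinTwoMul (n : ℕ) : Fin n ⊕ Fin n ≃ Fin (2 * n) :=
  finSumFinEquiv.trans (finCongr (two_mul n).symm)

theorem mergeVec_inl (x ξ : Fin n → ℝ) (j : Fin n) :
    mergeVec n x ξ (sumEquivFinTwoMul n (.inl j)) = x j := by
  simp [mergeVec, sumEquivFinTwoMul]

theorem mergeVec_inr (x ξ : Fin n → ℝ) (j : Fin n) :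
    mergeVec n x ξ (sumEquivFinTwoMul n (.inr j)) = ξ j := by
  simp [mergeVec, sumEquivFinTwoMul]

theorem mergeVec_dotProduct_mergeVec (x ξ x' ξ' : Fin n → ℝ) :
    mergeVec n x ξ ⬝ᵥ mergeVec n x' ξ' = x ⬝ᵥ x' + ξ ⬝ᵥ ξ' := by
  simp only [dotProduct, ← (sumEquivFinTwoMul n).sum_comp, Fintype.sum_sum_type, mergeVec_inl,
    mergeVec_inr]

/-- `mergeVec` as a continuous linear equivalence. -/
noncomputable def mergeCLE (n : ℕ) :
    ((Fin n → ℝ) × (Fin n → ℝ)) ≃L[ℝ] (Fin (2 * n) → ℝ) :=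
  LinearEquiv.toContinuousLinearEquiv
    { toFun := fun p => mergeVec n p.1 p.2
      map_add' := fun p q => by ext i; by_cases h : (i : ℕ) < n <;> simp [mergeVec, h]
      map_smul' := fun c p => by ext i; by_cases h : (i : ℕ) < n <;> simp [mergeVec, h]
      invFun := splitVec n
      left_inv := fun p => splitVec_mergeVec p.1 p.2
      right_inv := mergeVec_splitVec }

theorem mergeCLE_apply (p : (Fin n → ℝ) × (Fin n → ℝ)) : mergeCLE n p = mergeVec n p.1 p.2 := rfl

theorem measurePreserving_mergeCLE (n : ℕ) : MeasurePreserving (mergeCLE n) := by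
  have h := (volume_measurePreserving_piCongrLeft (fun _ => ℝ) (sumEquivFinTwoMul n)).comp
    (volume_measurePreserving_sumPiEquivProdPi_symm (fun _ : Fin n ⊕ Fin n => ℝ))
  convert! h using 1
  funext p i
  obtain ⟨j, rfl⟩ := (sumEquivFinTwoMul n).surjective i
  rw [mergeCLE_apply, Function.comp_apply, MeasurableEquiv.coe_piCongrLeft,
    Equiv.piCongrLeft_apply_apply]
  rcases j with j | j
  · rw [mergeVec_inl]; rfl
  · rw [mergeVec_inr]; rfl

theorem measurableEmbedding_mergeCLE (n : ℕ) : MeasurableEmbedding (mergeCLE n) :=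
  (mergeCLE n).toHomeomorph.measurableEmbedding

theorem Jmat_mulVec_mergeVec (x ξ : Fin n → ℝ) :
    Jmat n *ᵥ mergeVec n x ξ = mergeVec n ξ (-x) := by
  ext i
  obtain ⟨j, rfl⟩ := (sumEquivFinTwoMul n).surjective i
  have hadd : ∀ j k : Fin n, (j : ℕ) + n ≠ k := fun j k => by have := k.isLt; omega
  have hadd₂ : ∀ j k : Fin n, (j : ℕ) + n + n ≠ k := fun j k => by have := k.isLt; omega
  simp only [mulVec, dotProduct, ← (sumEquivFinTwoMul n).sum_comp, Fintype.sum_sum_type,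
    mergeVec_inl, mergeVec_inr]
  rcases j with j | j
  · rw [mergeVec_inl]
    simp [Jmat, sumEquivFinTwoMul, hadd, hadd₂, ← Fin.ext_iff]
  · rw [mergeVec_inr]
    simp [Jmat, sumEquivFinTwoMul, hadd, hadd₂, ← Fin.ext_iff]

theorem Jmat_inv (n : ℕ) : (Jmat n)⁻¹ = -Jmat n := by
  apply inv_eq_right_inv
  apply ext_of_mulVec_single
  intro i
  rw [← mergeVec_splitVec (Pi.single i (1 : ℝ)), ← mulVec_mulVec, neg_mulVec,
    Jmat_mulVec_mergeVec, mulVec_neg, Jmat_mulVec_mergeVec, one_mulVec]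
  ext k
  simp only [mergeVec, Pi.neg_apply]
  split_ifs <;> simp

/-- The standard symplectic form on pairs. -/
def stdForm (p q : (Fin n → ℝ) × (Fin n → ℝ)) : ℝ := p.2 ⬝ᵥ q.1 - p.1 ⬝ᵥ q.2

theorem symplForm_mulVec_mergeVec {Ω f : Matrix (Fin (2 * n)) (Fin (2 * n)) ℝ}
    (hf : IsUnit f.det) (hfJ : Ω = f * Jmat n * fᵀ) (p q : (Fin n → ℝ) × (Fin n → ℝ)) :
    symplForm Ω (f *ᵥ mergeVec n p.1 p.2) (f *ᵥ mergeVec n q.1 q.2) = stdForm p q := by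
  have hinv : fᵀ * (Ω⁻¹ * f) = -Jmat n := by
    have hft : IsUnit fᵀ.det := by rwa [det_transpose]
    rw [hfJ, Matrix.mul_inv_rev, Matrix.mul_inv_rev, Jmat_inv, Matrix.mul_assoc, Matrix.mul_assoc,
      nonsing_inv_mul _ hf, Matrix.mul_one, mul_nonsing_inv_cancel_left _ _ hft]
  have hdot : ∀ v w, f *ᵥ v ⬝ᵥ w = v ⬝ᵥ (fᵀ *ᵥ w) := fun v w => by
    rw [dotProduct_comm, dotProduct_mulVec, dotProduct_comm, mulVec_transpose]
  rw [symplForm, hdot, mulVec_mulVec, mulVec_mulVec, Matrix.mul_assoc, hinv, neg_mulVec,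
    Jmat_mulVec_mergeVec, dotProduct_neg, mergeVec_dotProduct_mergeVec, stdForm, dotProduct_neg]
  ring

theorem sqrt_abs_det_eq {Ω f : Matrix (Fin (2 * n)) (Fin (2 * n)) ℝ}
    (hΩ : IsUnit Ω.det) (hfJ : Ω = f * Jmat n * fᵀ) : √|Ω.det| = |f.det| := by
  have hJ : IsUnit (Jmat n).det := by
    rw [hfJ, det_mul, det_mul] at hΩ
    exact isUnit_of_mul_isUnit_right (isUnit_of_mul_isUnit_left hΩ)
  have h1 : |(Jmat n).det| = 1 := by
    have h := congrArg abs (congrArg det (mul_nonsing_inv _ hJ))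
    rw [Jmat_inv, det_mul, det_neg, det_one, abs_mul, abs_mul] at h
    simp only [Fintype.card_fin, abs_pow, abs_neg, abs_one, one_pow, one_mul] at h
    nlinarith [abs_nonneg (Jmat n).det]
  rw [hfJ, det_mul, det_mul, det_transpose, abs_mul, abs_mul, h1, mul_one,
    Real.sqrt_mul_self (abs_nonneg _)]

theorem integral_eq_abs_det_mul_integral {f : Matrix (Fin (2 * n)) (Fin (2 * n)) ℝ}
    (hf : IsUnit f.det) (h : (Fin (2 * n) → ℝ) → ℂ) :
    ∫ z, h z = ((|f.det| : ℝ) : ℂ) *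
      ∫ p : (Fin n → ℝ) × (Fin n → ℝ), h (f *ᵥ mergeVec n p.1 p.2) := by
  have hdet : f.det ≠ 0 := hf.ne_zero
  have h1 : ∫ p : (Fin n → ℝ) × (Fin n → ℝ), h (f *ᵥ mergeVec n p.1 p.2)
      = ∫ z, h (f *ᵥ z) :=
    (measurePreserving_mergeCLE n).integral_comp (measurableEmbedding_mergeCLE n)
      (fun z => h (f *ᵥ z))
  have hemb : MeasurableEmbedding (toLin' f) :=
    ((toLin' f).equivOfDetNeZero
      (by rwa [LinearMap.det_toLin'])).toContinuousLinearEquiv.toHomeomorph.measurableEmbedding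
  have h2 : ∫ z, h (f *ᵥ z) = ∫ z, h z ∂(Measure.map (toLin' f) volume) :=
    (hemb.integral_map h).symm
  rw [h1, h2, Real.map_matrix_volume_pi_eq_smul_volume_pi hdet, integral_smul_measure,
    ENNReal.toReal_ofReal (abs_nonneg _), Complex.real_smul, ← mul_assoc, ← Complex.ofReal_mul,
    ← abs_mul, mul_inv_cancel₀ hdet]
  simp

end PhaseSpace

section Fourier

open FourierTransform

variable {ι : Type*} [Fintype ι]

/-- The Fourier transform on `ι → ℝ` with phase `exp (-i ξ·x)`. -/
noncomputable def piFourier (g : (ι → ℝ) → ℂ) (ξ : ι → ℝ) : ℂ :=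
  ∫ x : ι → ℝ, Complex.exp (-Complex.I * ((ξ ⬝ᵥ x : ℝ) : ℂ)) * g x

theorem measurableEmbedding_ofLp (ι : Type*) :
    MeasurableEmbedding (WithLp.ofLp : EuclideanSpace ℝ ι → (ι → ℝ)) :=
  (MeasurableEquiv.toLp 2 (ι → ℝ)).symm.measurableEmbedding

theorem fourier_comp_ofLp (g : (ι → ℝ) → ℂ) (w : EuclideanSpace ℝ ι) :
    𝓕 (fun x : EuclideanSpace ℝ ι => g x.ofLp) w = piFourier g ((2 * Real.pi) • w.ofLp) := by
  rw [Real.fourier_eq', piFourier,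
    ← (PiLp.volume_preserving_ofLp ι).integral_comp (measurableEmbedding_ofLp ι)]
  congr 1
  ext x
  rw [smul_eq_mul, EuclideanSpace.inner_eq_star_dotProduct, smul_dotProduct]
  congr 2
  simp
  ring

theorem integrable_piFourier_iff (g : (ι → ℝ) → ℂ) :
    Integrable (𝓕 (fun x : EuclideanSpace ℝ ι => g x.ofLp)) ↔ Integrable (piFourier g) := by
  have h : 𝓕 (fun x : EuclideanSpace ℝ ι => g x.ofLp)
      = (fun w : ι → ℝ => piFourier g ((2 * Real.pi) • w)) ∘ WithLp.ofLp := by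
    ext w
    exact fourier_comp_ofLp g w
  rw [h, (PiLp.volume_preserving_ofLp ι).integrable_comp_emb (measurableEmbedding_ofLp ι),
    integrable_comp_smul_iff volume (piFourier g) (by positivity)]

theorem SchwartzMap.integrable_piFourier (a : SchwartzMap (ι → ℝ) ℂ) :
    Integrable (piFourier a) := by
  rw [← integrable_piFourier_iff]
  exact (𝓕 (SchwartzMap.compCLMOfContinuousLinearEquiv ℂ
    (PiLp.continuousLinearEquiv 2 ℝ (fun _ : ι => ℝ)) a)).integrable

theorem integral_piFourier_mul_exp {g : (ι → ℝ) → ℂ} (hc : Continuous g) (hg : Integrable g)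
    (hFg : Integrable (piFourier g)) (s : ι → ℝ) :
    ∫ ξ, piFourier g ξ * Complex.exp (Complex.I * ((ξ ⬝ᵥ s : ℝ) : ℂ))
      = (((2 * Real.pi) ^ Fintype.card ι : ℝ) : ℂ) * g s := by
  have hc' : Continuous (fun x : EuclideanSpace ℝ ι => g x.ofLp) := by fun_prop
  have hg' : Integrable (fun x : EuclideanSpace ℝ ι => g x.ofLp) :=
    ((PiLp.volume_preserving_ofLp ι).integrable_comp_emb (measurableEmbedding_ofLp ι)).2 hg
  have h := congrFun (hc'.fourierInv_fourier_eq hg' ((integrable_piFourier_iff g).2 hFg))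
    (WithLp.toLp 2 s)
  rw [Real.fourierInv_eq'] at h
  simp only [fourier_comp_ofLp] at h
  have h2 := Measure.integral_comp_smul volume
    (fun ξ => piFourier g ξ * Complex.exp (Complex.I * ((ξ ⬝ᵥ s : ℝ) : ℂ))) (2 * Real.pi)
  rw [← h]
  rw [← (PiLp.volume_preserving_ofLp ι).integral_comp (measurableEmbedding_ofLp ι)] at h2
  have h3 : ∀ v : EuclideanSpace ℝ ι,
      Complex.exp (((2 * Real.pi * inner ℝ v (WithLp.toLp 2 s) : ℝ) : ℂ) * Complex.I) •
        piFourier g ((2 * Real.pi) • v.ofLp)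
      = piFourier g ((2 * Real.pi) • v.ofLp) *
        Complex.exp (Complex.I * ((((2 * Real.pi) • v.ofLp) ⬝ᵥ s : ℝ) : ℂ)) := fun v => by
    rw [smul_eq_mul, mul_comm, EuclideanSpace.inner_eq_star_dotProduct, smul_dotProduct,
      dotProduct_comm]
    congr 2
    simp
    ring
  simp only [h3]
  rw [h2, Module.finrank_fintype_fun_eq_card, Complex.real_smul, ← mul_assoc,
    ← Complex.ofReal_mul, abs_of_pos (by positivity), mul_inv_cancel₀ (by positivity)]
  simp

end Fourier

section Weyl

variable {n : ℕ}

/-- The unnormalized standard symplectic Fourier transform on pairs. -/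
noncomputable def stdFourier (c : (Fin n → ℝ) × (Fin n → ℝ) → ℂ)
    (p : (Fin n → ℝ) × (Fin n → ℝ)) : ℂ :=
  ∫ q, Complex.exp (-Complex.I * ((stdForm p q : ℝ) : ℂ)) * c q

theorem norm_cexp_I_mul_ofReal (t : ℝ) : ‖Complex.exp (Complex.I * (t : ℂ))‖ = 1 := by
  rw [mul_comm, Complex.norm_exp_ofReal_mul_I]

theorem norm_cexp_neg_I_mul_ofReal (t : ℝ) : ‖Complex.exp (-Complex.I * (t : ℂ))‖ = 1 := by
  simpa using norm_cexp_I_mul_ofReal (-t)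

theorem SchwartzMap.integrable_volume_prod (c : SchwartzMap ((Fin n → ℝ) × (Fin n → ℝ)) ℂ) :
    Integrable c := by
  have h := (measurePreserving_mergeCLE n).integrable_comp_of_integrable
    (SchwartzMap.compCLMOfContinuousLinearEquiv ℂ (mergeCLE n).symm c).integrable
  simpa [Function.comp_def] using h

theorem SchwartzMap.integrable_stdFourier (c : SchwartzMap ((Fin n → ℝ) × (Fin n → ℝ)) ℂ) :
    Integrable (stdFourier c) := by
  set b := SchwartzMap.compCLMOfContinuousLinearEquiv ℂ (mergeCLE n).symm c with hb
  have hrot : MeasurePreserving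
      (fun p : (Fin n → ℝ) × (Fin n → ℝ) => mergeCLE n (Prod.map id Neg.neg p.swap)) :=
    (measurePreserving_mergeCLE n).comp
      (((MeasurePreserving.id volume).prod (Measure.measurePreserving_neg volume)).comp
        Measure.measurePreserving_swap)
  have h : stdFourier c = piFourier b ∘
      (fun p : (Fin n → ℝ) × (Fin n → ℝ) => mergeCLE n (Prod.map id Neg.neg p.swap)) := by
    ext p
    rw [Function.comp_apply, piFourier,
      ← (measurePreserving_mergeCLE n).integral_comp (measurableEmbedding_mergeCLE n), stdFourier]
    congr 1
    ext q
    simp only [hb, SchwartzMap.compCLMOfContinuousLinearEquiv_apply, Function.comp_apply,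
      ContinuousLinearEquiv.symm_apply_apply]
    rw [mergeCLE_apply, mergeCLE_apply, mergeVec_dotProduct_mergeVec]
    simp [stdForm, sub_eq_add_neg]
  rw [h]
  exact hrot.integrable_comp_of_integrable b.integrable_piFourier

theorem SchwartzMap.exists_integrable_bound_snd
    (c : SchwartzMap ((Fin n → ℝ) × (Fin n → ℝ)) ℂ) :
    ∃ B : (Fin n → ℝ) → ℝ, Integrable B ∧ ∀ x η, ‖c (x, η)‖ ≤ B η := by
  set C := 2 ^ (n + 1) * (Finset.Iic (n + 1, 0)).sup
    (fun m => SchwartzMap.seminorm ℝ m.1 m.2) c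
  refine ⟨fun η => C * (1 + ‖η‖) ^ (-((n + 1 : ℕ) : ℝ)), ?_, fun x η => ?_⟩
  · refine (integrable_one_add_norm ?_).const_mul C
    simp
  · have h := SchwartzMap.one_add_le_sup_seminorm_apply (𝕜 := ℝ) (m := (n + 1, 0))
      (k := n + 1) (n := 0) le_rfl le_rfl c (x, η)
    rw [norm_iteratedFDeriv_zero] at h
    have hη : ‖η‖ ≤ ‖(x, η)‖ := le_max_right _ _
    have hpos : 0 < (1 + ‖η‖) ^ (n + 1) := by positivity
    beta_reduce
    rw [Real.rpow_neg (by positivity), Real.rpow_natCast, ← div_eq_mul_inv, le_div_iff₀ hpos,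
      mul_comm]
    refine le_trans ?_ h
    gcongr

/-- Partial Fourier inversion for the symplectic Fourier transform. -/
theorem SchwartzMap.integral_stdFourier_mul_exp
    (c : SchwartzMap ((Fin n → ℝ) × (Fin n → ℝ)) ℂ) :
    ∀ᵐ x₀ : Fin n → ℝ, ∀ s : Fin n → ℝ,
      ∫ ξ₀ : Fin n → ℝ, stdFourier c (x₀, ξ₀) * Complex.exp (Complex.I * ((ξ₀ ⬝ᵥ s : ℝ) : ℂ))
        = (((2 * Real.pi) ^ n : ℝ) : ℂ) *
          ∫ η : Fin n → ℝ, Complex.exp (Complex.I * ((x₀ ⬝ᵥ η : ℝ) : ℂ)) * c (s, η) := by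
  filter_upwards [c.integrable_stdFourier.prod_right_ae] with x₀ hx₀ s
  have hc := c.continuous
  set g : (Fin n → ℝ) → ℂ := fun x =>
    ∫ η : Fin n → ℝ, Complex.exp (Complex.I * ((x₀ ⬝ᵥ η : ℝ) : ℂ)) * c (x, η) with hg
  have hint : Integrable (fun q : (Fin n → ℝ) × (Fin n → ℝ) =>
      Complex.exp (Complex.I * ((x₀ ⬝ᵥ q.2 : ℝ) : ℂ)) * c q) := by
    refine c.integrable_volume_prod.bdd_mul (c := 1) (Continuous.aestronglyMeasurable (by fun_prop))
      (Filter.Eventually.of_forall fun q => (norm_cexp_I_mul_ofReal _).le)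
  have hgc : Continuous g := by
    obtain ⟨B, hB, hcB⟩ := c.exists_integrable_bound_snd
    refine continuous_of_dominated (bound := B)
      (fun x => Continuous.aestronglyMeasurable (by fun_prop))
      (fun x => Filter.Eventually.of_forall fun η => ?_) hB
      (Filter.Eventually.of_forall fun η => by fun_prop)
    rw [norm_mul, norm_cexp_I_mul_ofReal, one_mul]
    exact hcB x η
  have hFg : ∀ ξ₀, stdFourier c (x₀, ξ₀) = piFourier g ξ₀ := fun ξ₀ => by
    have hint' : Integrable (fun q : (Fin n → ℝ) × (Fin n → ℝ) =>
        Complex.exp (-Complex.I * ((stdForm (x₀, ξ₀) q : ℝ) : ℂ)) * c q) := by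
      refine c.integrable_volume_prod.bdd_mul (c := 1)
        (Continuous.aestronglyMeasurable (by unfold stdForm; fun_prop))
        (Filter.Eventually.of_forall fun q => (norm_cexp_neg_I_mul_ofReal _).le)
    rw [stdFourier, piFourier, Measure.volume_eq_prod, integral_prod _ hint']
    refine integral_congr_ae (Filter.Eventually.of_forall fun x => ?_)
    simp only [hg, ← integral_const_mul, ← mul_assoc, ← Complex.exp_add]
    refine integral_congr_ae (Filter.Eventually.of_forall fun η => ?_)
    simp only [stdForm]
    congr 2
    push_cast
    ring
  simp only [hFg] at hx₀ ⊢
  rw [integral_piFourier_mul_exp hgc hint.integral_prod_left hx₀ s, Fintype.card_fin]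

/-- The Weyl operator as a superposition of Heisenberg–Weyl operators. -/
theorem SchwartzMap.integral_stdFourier_mul_heisenberg
    (c : SchwartzMap ((Fin n → ℝ) × (Fin n → ℝ)) ℂ) (u : SchwartzMap (Fin n → ℝ) ℂ)
    (x : Fin n → ℝ) :
    ∫ p : (Fin n → ℝ) × (Fin n → ℝ), stdFourier c p *
        (Complex.exp (Complex.I * ((p.2 ⬝ᵥ (x - (1/2 : ℝ) • p.1) : ℝ) : ℂ)) * u (x - p.1))
      = (((2 * Real.pi) ^ n : ℝ) : ℂ) * ∫ p : (Fin n → ℝ) × (Fin n → ℝ),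
          Complex.exp (Complex.I * (((x - p.1) ⬝ᵥ p.2 : ℝ) : ℂ)) *
            c ((1/2 : ℝ) • (x + p.1), p.2) * u p.1 := by
  have hc := c.continuous
  have hu := u.continuous
  obtain ⟨B, hB, hcB⟩ := c.exists_integrable_bound_snd
  obtain ⟨M, hM⟩ := u.decay 0 0
  have hM' : ∀ y, ‖u y‖ ≤ M := fun y => by simpa using hM.2 y
  have hl : Integrable (fun p : (Fin n → ℝ) × (Fin n → ℝ) => stdFourier c p *
      (Complex.exp (Complex.I * ((p.2 ⬝ᵥ (x - (1/2 : ℝ) • p.1) : ℝ) : ℂ)) * u (x - p.1))) := by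
    refine c.integrable_stdFourier.mul_bdd (c := M)
      (Continuous.aestronglyMeasurable (by fun_prop))
      (Filter.Eventually.of_forall fun p => ?_)
    rw [norm_mul, norm_cexp_I_mul_ofReal, one_mul]
    exact hM' _
  have hr : Integrable (fun p : (Fin n → ℝ) × (Fin n → ℝ) =>
      Complex.exp (Complex.I * (((x - p.1) ⬝ᵥ p.2 : ℝ) : ℂ)) *
        c ((1/2 : ℝ) • (x + p.1), p.2) * u p.1) := by
    refine (u.integrable.norm.mul_prod hB).mono'
      (Continuous.aestronglyMeasurable (by fun_prop))
      (Filter.Eventually.of_forall fun p => ?_)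
    rw [norm_mul, norm_mul, norm_cexp_I_mul_ofReal, one_mul, mul_comm]
    gcongr
    exact hcB _ _
  rw [Measure.volume_eq_prod] at hl hr ⊢
  rw [integral_prod _ hl, integral_prod _ hr]
  conv_rhs => rw [← integral_sub_left_eq_self _ volume x, ← integral_const_mul]
  refine integral_congr_ae ?_
  filter_upwards [c.integral_stdFourier_mul_exp] with x₀ hx₀
  simp only [← mul_assoc, integral_mul_const]
  rw [hx₀ (x - (1/2 : ℝ) • x₀), sub_sub_cancel]
  have hmid : (1/2 : ℝ) • (x + (x - x₀)) = x - (1/2 : ℝ) • x₀ := by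
    ext i; simp; ring
  rw [hmid, mul_assoc]

/-- Covariance of the cross-Wigner transform under Heisenberg–Weyl operators. -/
theorem exp_mul_crossWigner_sub (u v : (Fin n → ℝ) → ℂ) (z p : (Fin n → ℝ) × (Fin n → ℝ)) :
    Complex.exp (-Complex.I * ((stdForm z p : ℝ) : ℂ)) * crossWigner u v (z - (1/2 : ℝ) • p)
      = crossWigner (fun x => Complex.exp
          (Complex.I * ((p.2 ⬝ᵥ (x - (1/2 : ℝ) • p.1) : ℝ) : ℂ)) * u (x - p.1)) v z := by
  rw [crossWigner, crossWigner, mul_left_comm, ← integral_const_mul,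
    ← integral_sub_right_eq_self _ p.1]
  congr 2
  ext y
  have h1 : (z - (1/2 : ℝ) • p).1 + (1/2 : ℝ) • (y - p.1) = z.1 + (1/2 : ℝ) • y - p.1 := by
    ext i; simp; ring
  have h2 : (z - (1/2 : ℝ) • p).1 - (1/2 : ℝ) • (y - p.1) = z.1 - (1/2 : ℝ) • y := by
    ext i; simp; ring
  rw [h1, h2, ← mul_assoc, ← mul_assoc, ← mul_assoc, ← Complex.exp_add, ← Complex.exp_add]
  congr 3
  simp only [stdForm, Prod.snd_sub, Prod.smul_snd, sub_dotProduct, dotProduct_sub,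
    dotProduct_add, smul_dotProduct, dotProduct_smul, smul_eq_mul, dotProduct_comm p.2 z.1]
  push_cast
  ring

/-- The intertwining relation in the standard symplectic phase space. -/
theorem SchwartzMap.integral_stdFourier_mul_crossWigner
    (c : SchwartzMap ((Fin n → ℝ) × (Fin n → ℝ)) ℂ) (u φ : SchwartzMap (Fin n → ℝ) ℂ)
    (z : (Fin n → ℝ) × (Fin n → ℝ)) :
    ∫ p, stdFourier c p * (Complex.exp (-Complex.I * ((stdForm z p : ℝ) : ℂ)) *
        crossWigner u φ (z - (1/2 : ℝ) • p))
      = (((2 * Real.pi) ^ n : ℝ) : ℂ) * crossWigner (fun x =>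
          ∫ p : (Fin n → ℝ) × (Fin n → ℝ),
            Complex.exp (Complex.I * (((x - p.1) ⬝ᵥ p.2 : ℝ) : ℂ)) *
              c ((1/2 : ℝ) • (x + p.1), p.2) * u p.1) φ z := by
  have hu := u.continuous
  have hφc := φ.continuous
  obtain ⟨M, hM⟩ := u.decay 0 0
  have hM' : ∀ y, ‖u y‖ ≤ M := fun y => by simpa using hM.2 y
  have hφ : Integrable (fun y : Fin n → ℝ => φ (z.1 - (1/2 : ℝ) • y)) := by
    have h := (φ.integrable (μ := volume)).comp_sub_left z.1
    exact h.comp_smul (by norm_num : (1/2 : ℝ) ≠ 0)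
  have hprod : Integrable (Function.uncurry fun (p : (Fin n → ℝ) × (Fin n → ℝ))
      (y : Fin n → ℝ) => stdFourier c p * (Complex.exp (-Complex.I * ((z.2 ⬝ᵥ y : ℝ) : ℂ)) *
        (Complex.exp (Complex.I * ((p.2 ⬝ᵥ (z.1 + (1/2 : ℝ) • y - (1/2 : ℝ) • p.1) : ℝ) : ℂ)) *
          u (z.1 + (1/2 : ℝ) • y - p.1)) * conj (φ (z.1 - (1/2 : ℝ) • y))))
      (volume.prod volume) := by
    refine ((c.integrable_stdFourier.mul_prod hφ).norm.const_mul M).mono' ?_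
      (Filter.Eventually.of_forall fun q => ?_)
    · exact c.integrable_stdFourier.aestronglyMeasurable.comp_fst.mul
        (Continuous.aestronglyMeasurable (by fun_prop))
    · simp only [Function.uncurry, norm_mul, norm_cexp_I_mul_ofReal, norm_cexp_neg_I_mul_ofReal,
        one_mul, RCLike.norm_conj]
      rw [mul_left_comm]
      gcongr
      exact hM' _
  simp only [exp_mul_crossWigner_sub]
  simp only [crossWigner, mul_left_comm (stdFourier c _), integral_const_mul]
  rw [mul_left_comm]
  congr 1
  simp only [← integral_const_mul]
  rw [integral_integral_swap hprod]
  refine integral_congr_ae (Filter.Eventually.of_forall fun y => ?_)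
  simp only [integral_const_mul]
  rw [mul_right_comm _ _ (conj (φ _)), mul_left_comm,
    ← c.integral_stdFourier_mul_heisenberg u, ← integral_const_mul]
  refine integral_congr_ae (Filter.Eventually.of_forall fun p => ?_)
  simp only
  ring

end Weyl

theorem Fomega_mulVec_mergeVec {n : ℕ} {Ω f : Matrix (Fin (2 * n)) (Fin (2 * n)) ℝ}
    (hΩ : IsUnit Ω.det) (hf : IsUnit f.det) (hfJ : Ω = f * Jmat n * fᵀ)
    (a : (Fin (2 * n) → ℝ) → ℂ) (p : (Fin n → ℝ) × (Fin n → ℝ)) :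
    Fomega n Ω a (f *ᵥ mergeVec n p.1 p.2) = ((((2 * Real.pi) ^ n : ℝ)⁻¹ : ℝ) : ℂ) *
      stdFourier (fun q => a (f *ᵥ mergeVec n q.1 q.2)) p := by
  have hdet : |f.det| ≠ 0 := abs_ne_zero.2 hf.ne_zero
  rw [Fomega, integral_eq_abs_det_mul_integral hf, sqrt_abs_det_eq hΩ hfJ, mul_assoc,
    ← mul_assoc _ (((|f.det| : ℝ) : ℂ)), ← Complex.ofReal_mul, inv_mul_cancel₀ hdet]
  simp only [symplForm_mulVec_mergeVec hf hfJ, Complex.ofReal_one, one_mul, stdFourier]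

theorem wavePacketF_mulVec_mergeVec {n : ℕ} {f : Matrix (Fin (2 * n)) (Fin (2 * n)) ℝ}
    (hf : IsUnit f.det) (φ u : (Fin n → ℝ) → ℂ) (p : (Fin n → ℝ) × (Fin n → ℝ)) :
    wavePacketF n f φ u (f *ᵥ mergeVec n p.1 p.2) =
      ((√((2 * Real.pi) ^ n) : ℝ) : ℂ) * (((√|f.det|)⁻¹ : ℝ) : ℂ) * crossWigner u φ p := by
  rw [wavePacketF, mulVec_mulVec, nonsing_inv_mul _ hf, one_mulVec, splitVec_mergeVec]

theorem crossWigner_const_mul {n : ℕ} (k : ℂ) (u v : (Fin n → ℝ) → ℂ)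
    (z : (Fin n → ℝ) × (Fin n → ℝ)) :
    crossWigner (fun x => k * u x) v z = k * crossWigner u v z := by
  rw [crossWigner, crossWigner, mul_left_comm k, ← integral_const_mul k]
  congr 1
  refine integral_congr_ae (Filter.Eventually.of_forall fun y => ?_)
  simp only
  ring

/-- `Ã_ω(W_{f,φ}u) = W_{f,φ}(Â'u)` where `Â'` is the Weyl
operator with symbol `a' = a ∘ f`, for `Ω = f J fᵀ`. -/
theorem stmt14 (n : ℕ) (hn : 1 ≤ n)
    (Ω : Matrix (Fin (2 * n)) (Fin (2 * n)) ℝ)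
    (hΩ : IsUnit Ω.det) (hanti : Ωᵀ = -Ω)
    (f : Matrix (Fin (2 * n)) (Fin (2 * n)) ℝ)
    (hf : IsUnit f.det) (hfJ : Ω = f * Jmat n * fᵀ)
    (a : SchwartzMap (Fin (2 * n) → ℝ) ℂ)
    (u φ : SchwartzMap (Fin n → ℝ) ℂ)
    (hφ : ∫ x : Fin n → ℝ, ‖φ x‖ ^ 2 = 1)
    (z : Fin (2 * n) → ℝ) :
    Atilde n Ω (fun w => a w) (wavePacketF n f (fun w => φ w) (fun w => u w)) z
      = wavePacketF n f (fun w => φ w)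
          (weylOpM n (fun w => a (f *ᵥ w)) (fun w => u w)) z := by
  obtain ⟨p, rfl⟩ : ∃ p : (Fin n → ℝ) × (Fin n → ℝ), f *ᵥ mergeVec n p.1 p.2 = z :=
    ⟨splitVec n (f⁻¹ *ᵥ z), by
      rw [mergeVec_splitVec, mulVec_mulVec, mul_nonsing_inv _ hf, one_mulVec]⟩
  have hdet : ((|f.det| : ℝ) : ℂ) ≠ 0 :=
    Complex.ofReal_ne_zero.2 (abs_ne_zero.2 hf.ne_zero)
  have hpi : (((2 * Real.pi) ^ n : ℝ) : ℂ) ≠ 0 :=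
    Complex.ofReal_ne_zero.2 (by positivity)
  set c : SchwartzMap ((Fin n → ℝ) × (Fin n → ℝ)) ℂ :=
    SchwartzMap.compCLMOfContinuousLinearEquiv ℂ ((mergeCLE n).trans
      ((toLin' f).equivOfDetNeZero
        (by rw [LinearMap.det_toLin']; exact hf.ne_zero)).toContinuousLinearEquiv) a
  have hsub : ∀ q : (Fin n → ℝ) × (Fin n → ℝ),
      f *ᵥ mergeVec n p.1 p.2 - (1/2 : ℝ) • f *ᵥ mergeVec n q.1 q.2
        = f *ᵥ mergeVec n (p - (1/2 : ℝ) • q).1 (p - (1/2 : ℝ) • q).2 := fun q => by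
    rw [← mulVec_smul, ← mulVec_sub, ← mergeCLE_apply, ← mergeCLE_apply, ← mergeCLE_apply,
      map_sub, map_smul]
  have key := c.integral_stdFourier_mul_crossWigner u φ p
  rw [Atilde, integral_eq_abs_det_mul_integral hf, sqrt_abs_det_eq hΩ hfJ]
  simp only [Fomega_mulVec_mergeVec hΩ hf hfJ, symplForm_mulVec_mergeVec hf hfJ, hsub,
    wavePacketF_mulVec_mergeVec hf]
  have hweyl : crossWigner (weylOpM n (fun w => a (f *ᵥ w)) u) φ p
      = ((((2 * Real.pi) ^ n : ℝ)⁻¹ : ℝ) : ℂ) * crossWigner (fun x =>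
          ∫ p : (Fin n → ℝ) × (Fin n → ℝ),
            Complex.exp (Complex.I * (((x - p.1) ⬝ᵥ p.2 : ℝ) : ℂ)) *
              c ((1/2 : ℝ) • (x + p.1), p.2) * u p.1) φ p :=
    crossWigner_const_mul _ _ _ _
  have hconst : ∀ (P K : ℂ) (F G H : (Fin n → ℝ) × (Fin n → ℝ) → ℂ),
      ∫ q, P * F q * G q * (K * H q) = P * K * ∫ q, F q * (G q * H q) := fun P K F G H => by
    rw [← integral_const_mul]
    refine integral_congr_ae (Filter.Eventually.of_forall fun q => ?_)
    simp only
    ring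
  rw [hweyl, hconst]
  change _ * (_ * (_ * ∫ q, stdFourier c q * _)) = _
  rw [key]
  push_cast at hpi ⊢
  field_simp
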